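/- Let Λ̃ = (λ̃_ℓ)_{ℓ≥0} be a nonnegative nonincreasing sequence in ℓ¹(ℕ₀), and c > 1 with h_{⌊ℓ/2⌋}² ≤ c h_ℓ². Then e_n(H_{Λ̃})² ≥ min{ λ̃₀/2, (1/(4cn)) Σ_{ℓ > 2cn} λ̃_{2ℓ} }. -/

import Mathlib

open MeasureTheory RealInnerProductSpace

/-- Normalized Gegenbauer polynomials `G_ℓ` of index `(d−1)/2` with `G_ℓ(1) = 1`,
defined by the three-term recurrence
`G_{m+1}(t) = ((2m+d−1) t G_m(t) − m G_{m−1}(t))/(m+d−1)`. -/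
noncomputable def Geg (d : ℕ) : ℕ → ℝ → ℝ
  | 0 => fun _ => 1
  | 1 => fun t => t
  | n + 2 => fun t =>
      ((2 * (n : ℝ) + 1 + d) * t * Geg d (n + 1) t - ((n : ℝ) + 1) * Geg d n t) / ((n : ℝ) + d)

/-- Normalized integral against the Gegenbauer weight `w₀(t) = c₀(1−t²)^{(d−2)/2}` on `[−1,1]`. -/
noncomputable def gInt (d : ℕ) (f : ℝ → ℝ) : ℝ :=
  (∫ t in Set.Icc (-1 : ℝ) 1, ((1 - t ^ 2) ^ (((d : ℝ) - 2) / 2) : ℝ))⁻¹ *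
    ∫ t in Set.Icc (-1 : ℝ) 1, f t * (1 - t ^ 2) ^ (((d : ℝ) - 2) / 2)

/-- `h_k² = ⟨G_k²⟩`. -/
noncomputable def hsqG (d k : ℕ) : ℝ := gInt d fun t => Geg d k t ^ 2

/-- Gegenbauer linearization coefficients `C_k^{ℓ,s} = ⟨G_ℓ G_s G_k⟩ / h_k²`. -/
noncomputable def Ccoef (d k ℓ s : ℕ) : ℝ :=
  gInt d (fun t => Geg d ℓ t * Geg d s t * Geg d k t) / hsqG d k

/-- Convolution of sequences with respect to the Gegenbauer linearization coefficients. -/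
noncomputable def gconv (d : ℕ) (mu nu : ℕ → ℝ) (k : ℕ) : ℝ :=
  ∑' ℓ : ℕ, ∑' s : ℕ, Ccoef d k ℓ s * mu ℓ * nu s

/-- Kernel `K_Λ̃(x,y) = ∑_ℓ λ̃_ℓ G_ℓ(x⋅y)` of the space `H_Λ̃` on the sphere. -/
noncomputable def sphKernel (d : ℕ) (lam : ℕ → ℝ)
    (x y : EuclideanSpace ℝ (Fin (d + 1))) : ℝ :=
  ∑' ℓ : ℕ, lam ℓ * Geg d ℓ ⟪x, y⟫

/-- The squared optimal `n`-point quadrature error `e_n(H_Λ̃)²` for integration against the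
normalized surface measure on `S^d` over the unit ball of the RKHS `H_Λ̃` with kernel
`K_Λ̃(x,y) = ∑_ℓ λ̃_ℓ G_ℓ(x⋅y)`.  It is expressed via the standard RKHS identity for the squared
worst-case error of the rule `(c, x)`:
`‖h₀‖² − 2 ∑_j c_j h₀(x_j) + ∑_{j,k} c_j c_k K(x_j,x_k)`, where the representer of integration
is the constant `h₀ ≡ λ̃₀` with `‖h₀‖² = λ̃₀`. -/
noncomputable def enSq (d n : ℕ) (lam : ℕ → ℝ) : ℝ :=
  ⨅ (c : Fin n → ℝ)
    (x : Fin n → Metric.sphere (0 : EuclideanSpace ℝ (Fin (d + 1))) 1),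
      (lam 0 - 2 * lam 0 * ∑ j, c j +
        ∑ j, ∑ k, c j * c k * sphKernel d lam (x j) (x k))

set_option linter.all false

namespace S15

open Polynomial in
/-- Polynomial version of `Geg`. -/
noncomputable def GP (d : ℕ) : ℕ → ℝ[X]
  | 0 => 1
  | 1 => X
  | n + 2 => C (((n : ℝ) + d)⁻¹) *
      ((2 * (n : ℝ[X]) + 1 + (d : ℝ[X])) * X * GP d (n + 1) - ((n : ℝ[X]) + 1) * GP d n)

section
open Polynomial

lemma GP_eval (d : ℕ) (t : ℝ) : ∀ n, (GP d n).eval t = Geg d n t := by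
  intro n
  induction n using Nat.twoStepInduction with
  | zero => simp [GP, Geg]
  | one => simp [GP, Geg]
  | more n h1 h2 =>
    simp only [GP, Geg, eval_mul, eval_sub, eval_add, eval_C, eval_X, eval_natCast, h1, h2,
      eval_one, eval_ofNat]
    ring

lemma GP_rec (d : ℕ) (hd : 2 ≤ d) (n : ℕ) :
    ((n : ℝ[X]) + (d : ℝ[X])) * GP d (n + 2) =
      (2 * (n : ℝ[X]) + 1 + (d : ℝ[X])) * X * GP d (n + 1) - ((n : ℝ[X]) + 1) * GP d n := by
  have h : ((n : ℝ[X]) + (d : ℝ[X])) * C (((n : ℝ) + d)⁻¹) = 1 := by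
    have h1 : ((n : ℝ[X]) + (d : ℝ[X])) = C ((n : ℝ) + d) := by simp
    rw [h1, ← C_mul, mul_inv_cancel₀, C_1]
    positivity
  rw [GP, ← mul_assoc, h, one_mul]

lemma GP_ne (d : ℕ) (hd : 2 ≤ d) (n : ℕ) : ((n : ℝ[X]) + (d : ℝ[X])) ≠ 0 := by
  have : ((n + d : ℕ) : ℝ[X]) ≠ 0 := by
    rw [Nat.cast_ne_zero]; omega
  simpa using this

lemma GP_AR (d : ℕ) (hd : 2 ≤ d) (n : ℕ) :
    (1 - X ^ 2) * derivative (GP d (n + 1)) = ((n : ℝ[X]) + 1) * (GP d n - X * GP d (n + 1)) ∧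
    ((n : ℝ[X]) + (d : ℝ[X]) - 1) * X * derivative (GP d (n + 1)) - ((n : ℝ[X]) + 1) * derivative (GP d n)
      = ((n : ℝ[X]) + 1) * ((n : ℝ[X]) + (d : ℝ[X]) - 1) * GP d (n + 1) := by
  induction n with
  | zero => constructor <;> simp [GP] <;> ring
  | succ n ih =>
    obtain ⟨A, R⟩ := ih
    have rc := GP_rec d hd n
    have drec := congrArg derivative rc
    simp only [derivative_mul, derivative_sub, derivative_add, derivative_natCast, derivative_X,
      derivative_one, derivative_ofNat, zero_mul, add_zero, zero_add, mul_zero, mul_one] at drec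
    have R2 : ((n : ℝ[X]) + (d : ℝ[X])) * derivative (GP d (n + 2)) -
        ((n : ℝ[X]) + 2) * X * derivative (GP d (n + 1)) =
        ((n : ℝ[X]) + 2) * ((n : ℝ[X]) + (d : ℝ[X])) * GP d (n + 1) := by
      linear_combination drec + R
    have B : (1 - X ^ 2) * derivative (GP d (n + 1)) =
        ((n : ℝ[X]) + (d : ℝ[X])) * (X * GP d (n + 1) - GP d (n + 2)) := by
      linear_combination A + rc
    constructor
    · apply mul_left_cancel₀ (GP_ne d hd n)
      push_cast
      linear_combination (1 - X ^ 2) * R2 + ((n : ℝ[X]) + 2) * X * B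
    · push_cast
      linear_combination X * R2 - ((n : ℝ[X]) + 2) * B

lemma GP_ode (d : ℕ) (hd : 2 ≤ d) (n : ℕ) :
    (1 - X ^ 2) * derivative (derivative (GP d n)) - (d : ℝ[X]) * X * derivative (GP d n) =
      - ((n : ℝ[X]) * ((n : ℝ[X]) + (d : ℝ[X]) - 1)) * GP d n := by
  cases n with
  | zero => simp [GP]
  | succ n =>
    obtain ⟨A, R⟩ := GP_AR d hd n
    have dA := congrArg derivative A
    simp only [derivative_mul, derivative_sub, derivative_add, derivative_natCast, derivative_X,
      derivative_one, derivative_ofNat, zero_mul, add_zero, zero_add, mul_zero, mul_one, one_mul,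
      derivative_X_pow, zero_sub] at dA
    push_cast at dA ⊢
    simp only [map_ofNat, Nat.cast_ofNat, C_ofNat] at dA
    linear_combination dA - R

lemma GP_one (d : ℕ) (hd : 2 ≤ d) : ∀ n, (GP d n).eval 1 = 1 := by
  intro n
  induction n using Nat.twoStepInduction with
  | zero => simp [GP]
  | one => simp [GP]
  | more n h1 h2 =>
    have h := congrArg (eval 1) (GP_rec d hd n)
    simp only [eval_mul, eval_sub, eval_add, eval_X, eval_natCast, h1, h2,
      eval_one, eval_ofNat] at h
    have : ((n : ℝ) + d) ≠ 0 := by positivity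
    apply mul_left_cancel₀ this
    linear_combination h

/-- weight -/
noncomputable def wt (d : ℕ) (t : ℝ) : ℝ := (1 - t ^ 2) ^ (((d : ℝ) - 2) / 2)

lemma wt_cont (d : ℕ) (hd : 2 ≤ d) : Continuous (wt d) := by
  unfold wt
  have : (2 : ℝ) ≤ d := by exact_mod_cast hd
  exact Continuous.rpow_const (by fun_prop) (fun x => Or.inr (by linarith))

lemma wt_int (d : ℕ) (hd : 2 ≤ d) (p : ℝ[X]) :
    Integrable (fun t => p.eval t * wt d t) (volume.restrict (Set.Icc (-1 : ℝ) 1)) := by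
  have : Continuous (fun t => p.eval t * wt d t) := p.continuous.mul (wt_cont d hd)
  exact this.continuousOn.integrableOn_compact isCompact_Icc

lemma wt_pos (d : ℕ) (hd : 2 ≤ d) : 0 < ∫ t in Set.Icc (-1 : ℝ) 1, wt d t := by
  rw [integral_Icc_eq_integral_Ioc, ← intervalIntegral.integral_of_le (by norm_num)]
  apply intervalIntegral.intervalIntegral_pos_of_pos_on
  · exact (wt_cont d hd).intervalIntegrable _ _
  · intro x hx
    unfold wt
    apply Real.rpow_pos_of_pos
    nlinarith [hx.1, hx.2]
  · norm_num

/-- The Gegenbauer integral as a functional on polynomials. -/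
noncomputable def Lf (d : ℕ) (hd : 2 ≤ d) : ℝ[X] →ₗ[ℝ] ℝ where
  toFun p := gInt d (fun t => p.eval t)
  map_add' p q := by
    have := integral_add (wt_int d hd p) (wt_int d hd q)
    unfold wt at this
    simp only [gInt, eval_add, add_mul, this]
    ring
  map_smul' r p := by
    simp only [gInt, eval_smul, smul_eq_mul, mul_assoc, integral_const_mul, RingHom.id_apply]
    ring

lemma Lf_one (d : ℕ) (hd : 2 ≤ d) : Lf d hd 1 = 1 := by
  have := wt_pos d hd
  unfold wt at this
  simp only [Lf, gInt, LinearMap.coe_mk, AddHom.coe_mk, eval_one, one_mul]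
  exact inv_mul_cancel₀ this.ne'

lemma Lf_parts (d : ℕ) (hd : 2 ≤ d) (p : ℝ[X]) :
    Lf d hd ((1 - X ^ 2) * derivative p - (d : ℝ[X]) * X * p) = 0 := by
  simp only [Lf, gInt, LinearMap.coe_mk, AddHom.coe_mk]
  apply mul_eq_zero_of_right
  rw [integral_Icc_eq_integral_Ioc, ← intervalIntegral.integral_of_le (by norm_num)]
  have hd2 : (2 : ℝ) ≤ d := by exact_mod_cast hd
  have key := intervalIntegral.integral_eq_sub_of_hasDerivAt_of_le (a := -1) (b := 1)
    (f := fun t : ℝ => (1 - t ^ 2) ^ ((d : ℝ) / 2) * p.eval t)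
    (f' := fun t : ℝ => ((1 - X ^ 2) * derivative p - (d : ℝ[X]) * X * p).eval t *
      (1 - t ^ 2) ^ (((d : ℝ) - 2) / 2)) (by norm_num) ?_ ?_ ?_
  · rw [key]
    have : (d : ℝ) / 2 ≠ 0 := by positivity
    norm_num [Real.zero_rpow this]
  · refine ContinuousOn.mul ?_ p.continuous.continuousOn
    exact (Continuous.rpow_const (by fun_prop) (fun x => Or.inr (by positivity))).continuousOn
  · intro t ht
    have h0 : 0 < 1 - t ^ 2 := by nlinarith [ht.1, ht.2]
    have h1 : HasDerivAt (fun t : ℝ => 1 - t ^ 2) (-(2 * t)) t := by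
      have := ((hasDerivAt_id t).pow 2).const_sub 1
      simpa using this
    have h2 := h1.rpow_const (p := (d : ℝ) / 2) (Or.inl h0.ne')
    have h3 := h2.mul (p.hasDerivAt t)
    refine h3.congr_deriv ?_
    have e1 : (d : ℝ) / 2 - 1 = ((d : ℝ) - 2) / 2 := by ring
    have e2 : (1 - t ^ 2) ^ ((d : ℝ) / 2) = (1 - t ^ 2) ^ (((d : ℝ) - 2) / 2) * (1 - t ^ 2) := by
      rw [← Real.rpow_add_one h0.ne']; congr 1; ring
    rw [e1, e2]
    simp only [eval_mul, eval_sub, eval_one, eval_pow, eval_X, eval_natCast]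
    ring
  · exact ((((1 - X ^ 2) * derivative p - (d : ℝ[X]) * X * p).continuous).mul
      (wt_cont d hd)).intervalIntegrable _ _

lemma Lf_natCast_mul (d : ℕ) (hd : 2 ≤ d) (n : ℕ) (p : ℝ[X]) :
    Lf d hd ((n : ℝ[X]) * p) = n * Lf d hd p := by
  rw [← nsmul_eq_mul, map_nsmul, nsmul_eq_mul]

lemma Lf_orth (d : ℕ) (hd : 2 ≤ d) (m n : ℕ) (h : m ≠ n) :
    Lf d hd (GP d m * GP d n) = 0 := by
  have h1 := Lf_parts d hd (GP d m * derivative (GP d n) - GP d n * derivative (GP d m))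
  have h2 : (1 - X ^ 2) * derivative
        (GP d m * derivative (GP d n) - GP d n * derivative (GP d m)) -
      (d : ℝ[X]) * X * (GP d m * derivative (GP d n) - GP d n * derivative (GP d m)) =
      C ((m : ℝ) * (m + d - 1) - n * (n + d - 1)) * (GP d m * GP d n) := by
    simp only [derivative_mul, derivative_sub, C_sub, C_mul, C_add, C_1, C_eq_natCast, map_natCast]
    linear_combination GP d m * GP_ode d hd n - GP d n * GP_ode d hd m
  rw [h2, ← smul_eq_C_mul, map_smul, smul_eq_mul] at h1
  refine (mul_eq_zero.1 h1).resolve_left ?_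
  have hd2 : (2 : ℝ) ≤ d := by exact_mod_cast hd
  have e : (m : ℝ) * (m + d - 1) - n * (n + d - 1) = (m - n) * (m + n + d - 1) := by ring
  rw [e]
  refine mul_ne_zero (sub_ne_zero.2 (by exact_mod_cast h)) ?_
  have : (0:ℝ) ≤ m := by positivity
  have : (0:ℝ) ≤ n := by positivity
  linarith

/-- Triple products. -/
noncomputable def J (d : ℕ) (hd : 2 ≤ d) (m n k : ℕ) : ℝ := Lf d hd (GP d m * GP d n * GP d k)

noncomputable def hh (d : ℕ) (hd : 2 ≤ d) (m : ℕ) : ℝ := Lf d hd (GP d m * GP d m)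

lemma hh_eq (d : ℕ) (hd : 2 ≤ d) (m : ℕ) : hh d hd m = hsqG d m := by
  simp [hh, Lf, hsqG, GP_eval, sq]

lemma hh_zero (d : ℕ) (hd : 2 ≤ d) : hh d hd 0 = 1 := by
  simp [hh, GP, Lf_one]

/-- Multiplication by `X`, for all indices. -/
lemma GP_X (d : ℕ) (hd : 2 ≤ d) (m : ℕ) :
    C (2 * (m : ℝ) + d - 1) * (X * GP d m) =
      C ((m : ℝ) + d - 1) * GP d (m + 1) + C (m : ℝ) * GP d (m - 1) := by
  cases m with
  | zero => simp [GP]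
  | succ m =>
    have h := GP_rec d hd m
    simp only [C_sub, C_mul, C_add, C_1, C_eq_natCast, map_natCast, C_ofNat, map_ofNat,
      Nat.add_sub_cancel]
    push_cast
    linear_combination -h

lemma J_rec (d : ℕ) (hd : 2 ≤ d) (m n k : ℕ) :
    (2 * (k : ℝ) + d - 1) * (((m : ℝ) + d - 1) * J d hd (m + 1) n k + m * J d hd (m - 1) n k) =
    (2 * (m : ℝ) + d - 1) * (((k : ℝ) + d - 1) * J d hd m n (k + 1) + k * J d hd m n (k - 1)) := by
  have h1 := GP_X d hd m
  have h2 := GP_X d hd k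
  have : (2 * (k : ℝ) + d - 1) • (((m : ℝ) + d - 1) • (GP d (m + 1) * GP d n * GP d k) +
      (m : ℝ) • (GP d (m - 1) * GP d n * GP d k)) =
    (2 * (m : ℝ) + d - 1) • (((k : ℝ) + d - 1) • (GP d m * GP d n * GP d (k + 1)) +
      (k : ℝ) • (GP d m * GP d n * GP d (k - 1))) := by
    simp only [smul_eq_C_mul]
    linear_combination - C (2 * (k : ℝ) + d - 1) * GP d n * GP d k * h1
      + C (2 * (m : ℝ) + d - 1) * GP d n * GP d m * h2
  have h3 := congrArg (Lf d hd) this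
  simpa only [map_smul, map_add, smul_eq_mul, J] using h3

lemma J_zero (d : ℕ) (hd : 2 ≤ d) (n k : ℕ) :
    J d hd 0 n k = if n = k then hh d hd k else 0 := by
  split_ifs with h
  · subst h; simp [J, hh, GP]
  · simpa [J, GP] using Lf_orth d hd n k h

lemma J_swap12 (d : ℕ) (hd : 2 ≤ d) (m n k : ℕ) : J d hd m n k = J d hd n m k := by
  unfold J; congr 1; ring
lemma J_swap13 (d : ℕ) (hd : 2 ≤ d) (m n k : ℕ) : J d hd m n k = J d hd k n m := by
  unfold J; congr 1; ring
lemma J_swap23 (d : ℕ) (hd : 2 ≤ d) (m n k : ℕ) : J d hd m n k = J d hd m k n := by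
  unfold J; congr 1; ring

lemma hh_rec (d : ℕ) (hd : 2 ≤ d) (m : ℕ) :
    (2 * (m : ℝ) + d + 1) * (((m : ℝ) + d - 1) * hh d hd (m + 1)) =
    (2 * (m : ℝ) + d - 1) * (((m : ℝ) + 1) * hh d hd m) := by
  have h := J_rec d hd m 0 (m + 1)
  rw [J_swap12 d hd (m + 1) 0, J_swap12 d hd (m - 1) 0, J_swap12 d hd m 0, J_swap12 d hd m 0,
    J_zero, J_zero, J_zero, J_zero, Nat.add_sub_cancel] at h
  rw [if_neg (by omega : ¬ m - 1 = m + 1), if_neg (by omega : ¬ m = m + 1 + 1)] at h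
  push_cast at h
  rw [if_pos rfl, if_pos rfl] at h
  linear_combination h

lemma hh_pos (d : ℕ) (hd : 2 ≤ d) (m : ℕ) : 0 < hh d hd m := by
  induction m with
  | zero => rw [hh_zero]; norm_num
  | succ m ih =>
    have h := hh_rec d hd m
    have hd2 : (2 : ℝ) ≤ d := by exact_mod_cast hd
    have hm : (0:ℝ) ≤ m := by positivity
    have h1 : 0 < (2 * (m : ℝ) + d - 1) * (((m : ℝ) + 1) * hh d hd m) := by
      apply mul_pos (by linarith); positivity
    rw [← h, ← mul_assoc] at h1
    refine (pos_iff_pos_of_mul_pos h1).1 ?_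
    apply mul_pos <;> linarith

lemma hh_anti (d : ℕ) (hd : 2 ≤ d) : Antitone (hh d hd) := by
  apply antitone_nat_of_succ_le
  intro m
  have h := hh_rec d hd m
  have hd2 : (2 : ℝ) ≤ d := by exact_mod_cast hd
  have hm : (0:ℝ) ≤ m := by positivity
  have h0 := hh_pos d hd m
  have hp : 0 < (2 * (m : ℝ) + d + 1) * ((m : ℝ) + d - 1) := by apply mul_pos <;> linarith
  refine le_of_mul_le_mul_left ?_ hp
  rw [mul_assoc, h, ← mul_assoc]
  apply mul_le_mul_of_nonneg_right _ h0.le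
  nlinarith
end

section
open Polynomial

lemma J_tri (d : ℕ) (hd : 2 ≤ d) : ∀ n m k, n + k < m → J d hd n m k = 0 := by
  intro n
  have hd2 : (2 : ℝ) ≤ d := by exact_mod_cast hd
  induction n using Nat.strong_induction_on with
  | _ n ih =>
    intro m k h
    cases n with
    | zero => rw [J_zero, if_neg (by omega)]
    | succ n =>
      have r := J_rec d hd n m k
      rw [ih n (by omega) m (k + 1) (by omega)] at r
      rw [ih n (by omega) m (k - 1) (by omega)] at r
      rw [ih (n - 1) (by omega) m k (by omega)] at r
      have : (2 * (k : ℝ) + d - 1) * ((n : ℝ) + d - 1) ≠ 0 := by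
        have : (0:ℝ) ≤ k := by positivity
        have : (0:ℝ) ≤ n := by positivity
        apply mul_ne_zero <;> linarith
      apply (mul_eq_zero.1 (_ : _ * J d hd (n + 1) m k = 0)).resolve_left this
      linear_combination r

lemma J_odd (d : ℕ) (hd : 2 ≤ d) : ∀ n m k, (n + m + k) % 2 = 1 → J d hd n m k = 0 := by
  intro n
  have hd2 : (2 : ℝ) ≤ d := by exact_mod_cast hd
  induction n using Nat.strong_induction_on with
  | _ n ih =>
    intro m k h
    cases n with
    | zero => rw [J_zero, if_neg (by omega)]
    | succ n =>
      have r := J_rec d hd n m k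
      rw [ih n (by omega) m (k + 1) (by omega)] at r
      have e1 : (k : ℝ) * J d hd n m (k - 1) = 0 := by
        cases k with
        | zero => simp
        | succ k => rw [ih n (by omega) m (k + 1 - 1) (by omega), mul_zero]
      have e2 : (n : ℝ) * J d hd (n - 1) m k = 0 := by
        cases n with
        | zero => simp
        | succ n => rw [ih (n + 1 - 1) (by omega) m k (by omega), mul_zero]
      rw [e1, e2] at r
      have : (2 * (k : ℝ) + d - 1) * ((n : ℝ) + d - 1) ≠ 0 := by
        have : (0:ℝ) ≤ k := by positivity
        have : (0:ℝ) ≤ n := by positivity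
        apply mul_ne_zero <;> linarith
      apply (mul_eq_zero.1 (_ : _ * J d hd (n + 1) m k = 0)).resolve_left this
      linear_combination r

noncomputable def fu (D : ℝ) : ℕ → ℝ
  | 0 => 1
  | a + 1 => fu D a * ((D + 2 * a) / (2 * (a + 1)))
noncomputable def fw (D : ℝ) : ℕ → ℝ
  | 0 => 1
  | a + 1 => fw D a * (2 * (D + a) / (2 * a + 2 + D))
noncomputable def fv (D : ℝ) : ℕ → ℝ
  | 0 => 1
  | a + 1 => fv D a * ((D + a) / (a + 1))

lemma fu_pos {D : ℝ} (hD : 0 < D) (a : ℕ) : 0 < fu D a := by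
  induction a with
  | zero => simp [fu]
  | succ a ih => rw [fu]; positivity
lemma fw_pos {D : ℝ} (hD : 0 < D) (a : ℕ) : 0 < fw D a := by
  induction a with
  | zero => simp [fw]
  | succ a ih => rw [fw]; positivity
lemma fv_pos {D : ℝ} (hD : 0 < D) (a : ℕ) : 0 < fv D a := by
  induction a with
  | zero => simp [fv]
  | succ a ih => rw [fv]; positivity

noncomputable def FF (D : ℝ) (a b j : ℕ) : ℝ :=
  fu D a * fu D b * fu D j * fw D (a + b + j) / (fv D (a + j) * fv D (b + j) * fv D (a + b))

lemma FF_rec {D : ℝ} (hD : 0 < D) (a b j : ℕ) :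
    (2 * ((a : ℝ) + b + 1) + D) * (((a : ℝ) + j + 1 + D) * FF D (a + 1) b (j + 1) +
      (a + j + 1) * FF D a (b + 1) j) =
    (2 * ((a : ℝ) + j + 1) + D) * (((a : ℝ) + b + 1 + D) * FF D (a + 1) (b + 1) j +
      (a + b + 1) * FF D a b (j + 1)) := by
  have h1 := fu_pos hD a
  have h2 := fu_pos hD b
  have h3 := fu_pos hD j
  have h4 := fw_pos hD (a + b + j)
  have h5 := fv_pos hD (a + j)
  have h6 := fv_pos hD (b + j)
  have h7 := fv_pos hD (a + b)
  have e1 : a + 1 + b + (j + 1) = a + b + j + 1 + 1 := by omega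
  have e2 : a + 1 + (j + 1) = a + j + 1 + 1 := by omega
  have e3 : b + (j + 1) = b + j + 1 := by omega
  have e4 : a + 1 + b = a + b + 1 := by omega
  have e5 : a + (b + 1) + j = a + b + j + 1 := by omega
  have e6 : b + 1 + j = b + j + 1 := by omega
  have e7 : a + (b + 1) = a + b + 1 := by omega
  have e8 : a + 1 + (b + 1) + j = a + b + j + 1 + 1 := by omega
  have e9 : a + 1 + j = a + j + 1 := by omega
  have e10 : a + 1 + (b + 1) = a + b + 1 + 1 := by omega
  have e11 : a + b + (j + 1) = a + b + j + 1 := by omega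
  have e12 : a + (j + 1) = a + j + 1 := by omega
  unfold FF
  rw [e1, e2, e3, e4, e5, e6, e7, e8, e9, e10, e11, e12]
  simp only [fu, fv, fw]
  push_cast
  generalize fu D a = x1 at *
  generalize fu D b = x2 at *
  generalize fu D j = x3 at *
  generalize fw D (a + b + j) = x4 at *
  generalize fv D (a + j) = x5 at *
  generalize fv D (b + j) = x6 at *
  generalize fv D (a + b) = x7 at *
  have ha : (0:ℝ) ≤ a := by positivity
  have hb : (0:ℝ) ≤ b := by positivity
  have hj : (0:ℝ) ≤ j := by positivity
  generalize (a : ℝ) = a at *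
  generalize (b : ℝ) = b at *
  generalize (j : ℝ) = j at *
  field_simp
  ring

lemma FF_rec0 {D : ℝ} (hD : 0 < D) (b j : ℕ) :
    (2 * (b : ℝ) + D) * (((j : ℝ) + D) * FF D 0 b (j + 1)) =
    (2 * (j : ℝ) + D) * (((b : ℝ) + D) * FF D 0 (b + 1) j) := by
  have h1 := fu_pos hD b
  have h3 := fu_pos hD j
  have h4 := fw_pos hD (b + j)
  have h5 := fv_pos hD j
  have h6 := fv_pos hD (b + j)
  have h7 := fv_pos hD b
  have e3 : b + (j + 1) = b + j + 1 := by omega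
  have e6 : b + 1 + j = b + j + 1 := by omega
  unfold FF
  simp only [zero_add]
  rw [e3, e6]
  simp only [fu, fv, fw]
  push_cast
  field_simp
  ring

lemma FF_base {D : ℝ} (hD : 0 < D) (b : ℕ) :
    (2 * (b : ℝ) + D + 2) * ((b + D) * FF D 0 (b + 1) 0) =
      (2 * (b : ℝ) + D) * ((b + 1) * FF D 0 b 0) := by
  have h1 := fu_pos hD b
  have h4 := fw_pos hD b
  have h7 := fv_pos hD b
  unfold FF
  simp only [zero_add, add_zero]
  simp only [fu, fv, fw]
  field_simp
  ring

lemma J_F0 (d : ℕ) (hd : 2 ≤ d) (j : ℕ) :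
    ∀ b, J d hd j (b + j) b = FF ((d : ℝ) - 1) 0 b j := by
  have hd2 : (2 : ℝ) ≤ d := by exact_mod_cast hd
  have hD : 0 < (d : ℝ) - 1 := by linarith
  induction j with
  | zero =>
    intro b
    rw [J_zero, if_pos (by omega)]
    induction b with
    | zero => simp [hh_zero, FF, fu, fv, fw]
    | succ b ih =>
      have r := hh_rec d hd b
      rw [ih] at r
      have : (2 * (b : ℝ) + d + 1) * ((b : ℝ) + d - 1) ≠ 0 := by
        have : (0:ℝ) ≤ b := by positivity
        apply mul_ne_zero <;> linarith
      apply mul_left_cancel₀ this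
      linear_combination r - FF_base hD b
  | succ j ih =>
    intro b
    have r := J_rec d hd j (b + (j + 1)) b
    have i1 := ih (b + 1)
    rw [show b + 1 + j = b + (j + 1) by omega] at i1
    rw [i1] at r
    have e1 : (b : ℝ) * J d hd j (b + (j + 1)) (b - 1) = 0 := by
      rw [J_tri d hd _ _ _ (by omega), mul_zero]
    have e2 : (j : ℝ) * J d hd (j - 1) (b + (j + 1)) b = 0 := by
      rw [J_tri d hd _ _ _ (by omega), mul_zero]
    rw [e1, e2] at r
    have : (2 * (b : ℝ) + d - 1) * ((j : ℝ) + d - 1) ≠ 0 := by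
      have : (0:ℝ) ≤ b := by positivity
      have : (0:ℝ) ≤ j := by positivity
      apply mul_ne_zero <;> linarith
    apply mul_left_cancel₀ this
    linear_combination r - FF_rec0 hD b j

lemma FF_symm (D : ℝ) (a b : ℕ) : FF D a b 0 = FF D 0 b a := by
  simp only [FF, add_zero, zero_add]
  rw [add_comm b a]; ring

lemma J_F (d : ℕ) (hd : 2 ≤ d) (a : ℕ) :
    ∀ j b, J d hd (a + j) (b + j) (a + b) = FF ((d : ℝ) - 1) a b j := by
  have hd2 : (2 : ℝ) ≤ d := by exact_mod_cast hd
  have hD : 0 < (d : ℝ) - 1 := by linarith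
  induction a with
  | zero => intro j b; simpa using J_F0 d hd j b
  | succ a iha =>
    intro j
    induction j with
    | zero =>
      intro b
      rw [FF_symm, ← J_F0 d hd, J_swap23, add_zero, add_zero, add_comm b]
    | succ j ihj =>
      intro b
      have r := J_rec d hd (a + j + 1) (b + j + 1) (a + b + 1)
      have i1 := iha j (b + 1)
      have i2 := ihj (b + 1)
      have i3 := iha (j + 1) b
      rw [show b + 1 + j = b + j + 1 by omega, show a + (b + 1) = a + b + 1 by omega] at i1
      rw [show b + 1 + j = b + j + 1 by omega, show a + 1 + (b + 1) = a + b + 1 + 1 by omega,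
        show a + 1 + j = a + j + 1 by omega] at i2
      rw [show b + (j + 1) = b + j + 1 by omega, show a + (j + 1) = a + j + 1 by omega] at i3
      rw [Nat.add_sub_cancel, Nat.add_sub_cancel, i1, i2, i3] at r
      rw [show a + 1 + (j + 1) = a + j + 1 + 1 by omega, show b + (j + 1) = b + j + 1 by omega,
        show a + 1 + b = a + b + 1 by omega]
      have f := FF_rec hD a b j
      push_cast at r
      have : (2 * ((a : ℝ) + b + 1) + d - 1) * ((a : ℝ) + j + 1 + d - 1) ≠ 0 := by
        have : (0:ℝ) ≤ a := by positivity
        have : (0:ℝ) ≤ b := by positivity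
        have : (0:ℝ) ≤ j := by positivity
        apply mul_ne_zero <;> linarith
      apply mul_left_cancel₀ this
      linear_combination r - f

lemma J_nonneg (d : ℕ) (hd : 2 ≤ d) (m n k : ℕ) : 0 ≤ J d hd m n k := by
  have hd2 : (2 : ℝ) ≤ d := by exact_mod_cast hd
  have hD : 0 < (d : ℝ) - 1 := by linarith
  by_cases h1 : m + k < n
  · rw [J_tri d hd _ _ _ h1]
  by_cases h2 : n + k < m
  · rw [J_swap12, J_tri d hd _ _ _ h2]
  by_cases h3 : m + n < k
  · rw [J_swap23, J_tri d hd _ _ _ h3]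
  by_cases h4 : (m + n + k) % 2 = 1
  · rw [J_odd d hd _ _ _ h4]
  have := J_F d hd ((m + k - n) / 2) ((m + n - k) / 2) ((n + k - m) / 2)
  rw [show (m + k - n) / 2 + (m + n - k) / 2 = m by omega,
    show (n + k - m) / 2 + (m + n - k) / 2 = n by omega,
    show (m + k - n) / 2 + (n + k - m) / 2 = k by omega] at this
  rw [this, FF]
  have := fu_pos hD
  have := fw_pos hD
  have := fv_pos hD
  apply div_nonneg
  · apply mul_nonneg (mul_nonneg (mul_nonneg _ _) _) <;> exact (by simp [*, le_of_lt])
  · apply mul_nonneg (mul_nonneg _ _) <;> exact (by simp [*, le_of_lt])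

lemma GP_span (d : ℕ) (hd : 2 ≤ d) (p : ℝ[X]) : p ∈ Submodule.span ℝ (Set.range (GP d)) := by
  have hd2 : (2 : ℝ) ≤ d := by exact_mod_cast hd
  have hX : ∀ q ∈ Submodule.span ℝ (Set.range (GP d)),
      X * q ∈ Submodule.span ℝ (Set.range (GP d)) := by
    intro q hq
    induction hq using Submodule.span_induction with
    | mem q hq =>
      obtain ⟨m, rfl⟩ := hq
      have h := GP_X d hd m
      have h0 : 2 * (m : ℝ) + d - 1 ≠ 0 := by
        have : (0:ℝ) ≤ m := by positivity
        linarith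
      have h1 : X * GP d m = (2 * (m : ℝ) + d - 1)⁻¹ •
          (((m : ℝ) + d - 1) • GP d (m + 1) + (m : ℝ) • GP d (m - 1)) := by
        rw [smul_eq_C_mul, smul_eq_C_mul, smul_eq_C_mul, ← h, ← mul_assoc, ← C_mul,
          inv_mul_cancel₀ h0, C_1, one_mul]
      rw [h1]
      exact Submodule.smul_mem _ _ (Submodule.add_mem _
        (Submodule.smul_mem _ _ (Submodule.subset_span ⟨_, rfl⟩))
        (Submodule.smul_mem _ _ (Submodule.subset_span ⟨_, rfl⟩)))
    | zero => simp
    | add x y _ _ hx hy => rw [mul_add]; exact Submodule.add_mem _ hx hy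
    | smul a x _ hx => rw [mul_smul_comm]; exact Submodule.smul_mem _ _ hx
  have h1 : ∀ n : ℕ, (X : ℝ[X]) ^ n ∈ Submodule.span ℝ (Set.range (GP d)) := by
    intro n
    induction n with
    | zero => exact Submodule.subset_span ⟨0, by simp [GP]⟩
    | succ n ih => rw [pow_succ']; exact hX _ ih
  rw [p.as_sum_range_C_mul_X_pow]
  refine Submodule.sum_mem _ fun i _ => ?_
  rw [← smul_eq_C_mul]
  exact Submodule.smul_mem _ _ (h1 i)

lemma GP_lin (d : ℕ) (hd : 2 ≤ d) (m n M : ℕ) (hM : m + n < M) :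
    GP d m * GP d n = ∑ k ∈ Finset.range M, (J d hd m n k / hh d hd k) • GP d k := by
  obtain ⟨a, ha⟩ := (Finsupp.mem_span_range_iff_exists_finsupp).1 (GP_span d hd (GP d m * GP d n))
  have hco : ∀ k, a k = J d hd m n k / hh d hd k := by
    intro k
    rw [eq_div_iff (hh_pos d hd k).ne', J, ← ha, Finsupp.sum_mul, Finsupp.sum, map_sum]
    rw [Finset.sum_eq_single k]
    · rw [smul_mul_assoc, map_smul, smul_eq_mul, hh]
    · intro b _ hb
      rw [smul_mul_assoc, map_smul, Lf_orth d hd b k hb, smul_zero]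
    · intro h
      rw [Finsupp.notMem_support_iff.1 h, zero_smul, zero_mul, map_zero]
  rw [← ha, Finsupp.sum]
  simp only [hco]
  apply Finset.sum_subset
  · intro k hk
    by_contra h
    rw [Finset.mem_range] at h
    rw [Finsupp.mem_support_iff, hco] at hk
    apply hk
    rw [J_swap23, J_tri d hd m k n (by omega), zero_div]
  · intro k _ hk
    rw [← hco, Finsupp.notMem_support_iff.1 hk, zero_smul]

lemma Geg_lin (d : ℕ) (hd : 2 ≤ d) (m n M : ℕ) (hM : m + n < M) (t : ℝ) :
    Geg d m t * Geg d n t = ∑ k ∈ Finset.range M, (J d hd m n k / hh d hd k) * Geg d k t := by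
  have h := congrArg (eval t) (GP_lin d hd m n M hM)
  rw [eval_mul, eval_finset_sum] at h
  simpa [eval_smul, GP_eval] using h

lemma Geg_one (d : ℕ) (hd : 2 ≤ d) (n : ℕ) : Geg d n 1 = 1 := by
  rw [← GP_eval, GP_one d hd]

lemma J_sum_le (d : ℕ) (hd : 2 ≤ d) (m n N : ℕ) :
    ∑ k ∈ Finset.range N, J d hd m n k / hh d hd k ≤ 1 := by
  have h := Geg_lin d hd m n (m + n + 1 + N) (by omega) 1
  simp only [Geg_one d hd, mul_one] at h
  rw [h]
  apply Finset.sum_le_sum_of_subset_of_nonneg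
  · intro x; simp only [Finset.mem_range]; omega
  · intro i _ _
    exact div_nonneg (J_nonneg d hd _ _ _) (hh_pos d hd i).le
end

section
open MvPolynomial

variable {σ : Type} [Fintype σ] [DecidableEq σ]

/-- factorial weight of a monomial -/
noncomputable def mfac (m : σ →₀ ℕ) : ℝ := ∏ i, ((m i).factorial : ℝ)

lemma mfac_pos (m : σ →₀ ℕ) : 0 < mfac m := by
  unfold mfac
  exact Finset.prod_pos fun i _ => by exact_mod_cast Nat.factorial_pos _

lemma mfac_succ (m : σ →₀ ℕ) (i : σ) :
    mfac (m + Finsupp.single i 1) = ((m i : ℝ) + 1) * mfac m := by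
  unfold mfac
  rw [← Finset.mul_prod_erase _ _ (Finset.mem_univ i),
    ← Finset.mul_prod_erase Finset.univ (fun i => ((m i).factorial : ℝ)) (Finset.mem_univ i),
    ← mul_assoc]
  congr 1
  · simp [Nat.factorial_succ]
  · apply Finset.prod_congr rfl
    intro j hj
    have : i ≠ j := (Finset.ne_of_mem_erase hj).symm
    simp [this]

/-- Fischer bilinear form. -/
noncomputable def FB : MvPolynomial σ ℝ →ₗ[ℝ] MvPolynomial σ ℝ →ₗ[ℝ] ℝ :=
  (basisMonomials σ ℝ).constr ℝ (fun m => mfac m • lcoeff ℝ m)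

lemma FB_monomial (m : σ →₀ ℕ) (q : MvPolynomial σ ℝ) :
    FB (monomial m 1) q = mfac m * coeff m q := by
  have : (basisMonomials σ ℝ) m = monomial m 1 := by simp
  rw [← this, FB, Module.Basis.constr_basis]
  simp [lcoeff_apply]

lemma FB_sum (p q : MvPolynomial σ ℝ) :
    FB p q = ∑ m ∈ p.support, coeff m p * (mfac m * coeff m q) := by
  conv_lhs => rw [p.as_sum]
  rw [map_sum, LinearMap.sum_apply]
  apply Finset.sum_congr rfl
  intro m _
  rw [← FB_monomial, ← smul_eq_mul, ← LinearMap.smul_apply, ← map_smul, smul_monomial]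
  simp

lemma FB_nonneg (p : MvPolynomial σ ℝ) : 0 ≤ FB p p := by
  rw [FB_sum]
  apply Finset.sum_nonneg
  intro m _
  have := mfac_pos m
  nlinarith [mul_nonneg this.le (mul_self_nonneg (coeff m p))]

lemma FB_X (i : σ) (p q : MvPolynomial σ ℝ) : FB (X i * p) q = FB p (pderiv i q) := by
  induction p using MvPolynomial.induction_on' with
  | monomial m a =>
    have e1 : X i * monomial m a = a • monomial (m + Finsupp.single i 1) (1 : ℝ) := by
      rw [X, monomial_mul, one_mul, smul_monomial, smul_eq_mul, mul_one, add_comm]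
    have e2 : monomial m a = a • monomial m (1 : ℝ) := by
      rw [smul_monomial, smul_eq_mul, mul_one]
    rw [e1, e2, map_smul, map_smul, LinearMap.smul_apply, LinearMap.smul_apply, FB_monomial,
      FB_monomial, mfac_succ, coeff_pderiv]
    simp only [smul_eq_mul, nsmul_eq_mul]
    push_cast
    ring
  | add p1 p2 h1 h2 => rw [mul_add, map_add, map_add, LinearMap.add_apply, LinearMap.add_apply, h1, h2]

noncomputable def Lx (x : σ → ℝ) : MvPolynomial σ ℝ := ∑ i, C (x i) * X i
noncomputable def NN (σ : Type) [Fintype σ] : MvPolynomial σ ℝ := ∑ i, X i ^ 2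
noncomputable def Dx (x : σ → ℝ) : Derivation ℝ (MvPolynomial σ ℝ) (MvPolynomial σ ℝ) :=
  ∑ i, x i • pderiv i
noncomputable def Lap : MvPolynomial σ ℝ →ₗ[ℝ] MvPolynomial σ ℝ :=
  ∑ i, (pderiv i).toLinearMap ∘ₗ (pderiv i).toLinearMap

lemma Dx_apply (x : σ → ℝ) (p : MvPolynomial σ ℝ) : Dx x p = ∑ i, C (x i) * pderiv i p := by
  have h := congrFun (map_sum (Derivation.coeFnAddMonoidHom (R := ℝ) (A := MvPolynomial σ ℝ)
    (M := MvPolynomial σ ℝ)) (fun i => x i • pderiv i) Finset.univ) p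
  simp only [Finset.sum_apply, Derivation.coeFnAddMonoidHom, AddMonoidHom.coe_mk, ZeroHom.coe_mk,
    Derivation.smul_apply, smul_eq_C_mul] at h
  exact h

lemma Lap_apply (p : MvPolynomial σ ℝ) : Lap p = ∑ i, pderiv i (pderiv i p) := by
  simp [Lap, LinearMap.sum_apply]

lemma FB_L (x : σ → ℝ) (p q : MvPolynomial σ ℝ) : FB (Lx x * p) q = FB p (Dx x q) := by
  rw [Lx, Finset.sum_mul, map_sum, LinearMap.sum_apply, Dx_apply, map_sum]
  apply Finset.sum_congr rfl
  intro i _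
  rw [mul_assoc, ← smul_eq_C_mul, ← smul_eq_C_mul, map_smul, map_smul, LinearMap.smul_apply, FB_X]

lemma FB_N (p q : MvPolynomial σ ℝ) : FB (NN σ * p) q = FB p (Lap q) := by
  rw [NN, Finset.sum_mul, map_sum, LinearMap.sum_apply, Lap_apply, map_sum]
  apply Finset.sum_congr rfl
  intro i _
  rw [pow_two, mul_assoc, FB_X, FB_X]

lemma pd_comm (i j : σ) (p : MvPolynomial σ ℝ) : pderiv i (pderiv j p) = pderiv j (pderiv i p) := by
  have : ⁅(pderiv i : Derivation ℝ (MvPolynomial σ ℝ) (MvPolynomial σ ℝ)),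
      (pderiv j : Derivation ℝ (MvPolynomial σ ℝ) (MvPolynomial σ ℝ))⁆ = 0 := by
    apply MvPolynomial.derivation_ext
    intro k
    rw [Derivation.commutator_apply]
    simp [pderiv_X, Pi.single_apply, apply_ite]
  have h := congrArg (fun D => D p) this
  simp only [Derivation.commutator_apply, Derivation.coe_zero, Pi.zero_apply] at h
  exact sub_eq_zero.1 h

lemma Lap_Dx (x : σ → ℝ) (p : MvPolynomial σ ℝ) : Lap (Dx x p) = Dx x (Lap p) := by
  simp only [Lap_apply, Dx_apply, map_sum, Finset.mul_sum]
  rw [Finset.sum_comm]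
  apply Finset.sum_congr rfl
  intro i _
  apply Finset.sum_congr rfl
  intro j _
  rw [pderiv_C_mul, pderiv_C_mul, pd_comm j i, pd_comm j i]

lemma pd_L (x : σ → ℝ) (i : σ) : pderiv i (Lx x) = C (x i) := by
  simp [Lx, pderiv_X, Pi.single_apply, Derivation.leibniz]

lemma pd_N (i : σ) : pderiv i (NN σ) = 2 * X i := by
  simp [NN, pderiv_X, Pi.single_apply, Derivation.leibniz_pow]

lemma Lap_L (x : σ → ℝ) (p : MvPolynomial σ ℝ) :
    Lap (Lx x * p) = Lx x * Lap p + 2 * Dx x p := by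
  simp only [Lap_apply, Dx_apply, Derivation.leibniz, smul_eq_mul, pd_L, map_add, pderiv_C,
    Finset.mul_sum, ← Finset.sum_add_distrib]
  apply Finset.sum_congr rfl
  intro i _
  ring

lemma Lap_N (p : MvPolynomial σ ℝ) (k : ℕ) (hp : p.IsHomogeneous k) :
    Lap (NN σ * p) = NN σ * Lap p + (4 * (k : MvPolynomial σ ℝ) + 2 * (Fintype.card σ)) * p := by
  have hE := hp.sum_X_mul_pderiv
  have h2 : ∀ i : σ, pderiv i (2 : MvPolynomial σ ℝ) = 0 := fun i => by
    have : (2 : MvPolynomial σ ℝ) = C 2 := (map_ofNat C 2).symm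
    rw [this, pderiv_C]
  have : Lap (NN σ * p) = NN σ * Lap p + 4 * ∑ i, X i * pderiv i p + ∑ i : σ, 2 * p := by
    simp only [Lap_apply, Derivation.leibniz, smul_eq_mul, pd_N, map_add, h2,
      Finset.mul_sum, ← Finset.sum_add_distrib]
    apply Finset.sum_congr rfl
    intro i _
    simp
    ring
  rw [this, hE]
  simp
  ring

/-- Zonal harmonic polynomial with pole `x`. -/
noncomputable def PX (d : ℕ) (x : σ → ℝ) : ℕ → MvPolynomial σ ℝ
  | 0 => 1
  | 1 => Lx x
  | n + 2 => C (((n : ℝ) + d)⁻¹) *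
      ((2 * (n : MvPolynomial σ ℝ) + 1 + (d : MvPolynomial σ ℝ)) * (Lx x * PX d x (n + 1)) -
        ((n : MvPolynomial σ ℝ) + 1) * (NN σ * PX d x n))

lemma PX_rec (d : ℕ) (hd : 2 ≤ d) (x : σ → ℝ) (n : ℕ) :
    ((n : MvPolynomial σ ℝ) + (d : MvPolynomial σ ℝ)) * PX d x (n + 2) =
      (2 * (n : MvPolynomial σ ℝ) + 1 + (d : MvPolynomial σ ℝ)) * (Lx x * PX d x (n + 1)) -
        ((n : MvPolynomial σ ℝ) + 1) * (NN σ * PX d x n) := by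
  have h : ((n : MvPolynomial σ ℝ) + (d : MvPolynomial σ ℝ)) * C (((n : ℝ) + d)⁻¹) = 1 := by
    have h1 : ((n : MvPolynomial σ ℝ) + (d : MvPolynomial σ ℝ)) = C ((n : ℝ) + d) := by simp
    rw [h1, ← C_mul, mul_inv_cancel₀, C_1]
    positivity
  rw [PX, ← mul_assoc, h, one_mul]

lemma PX_ne (d : ℕ) (hd : 2 ≤ d) (n : ℕ) :
    ((n : MvPolynomial σ ℝ) + (d : MvPolynomial σ ℝ)) ≠ 0 := by
  have : ((n + d : ℕ) : MvPolynomial σ ℝ) ≠ 0 := by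
    rw [Nat.cast_ne_zero]; omega
  simpa using this

lemma PX_hom (d : ℕ) (x : σ → ℝ) (n : ℕ) : (PX d x n).IsHomogeneous n := by
  have hL : (Lx x).IsHomogeneous 1 := by
    apply IsHomogeneous.sum
    intro i _
    simpa using (isHomogeneous_C σ (x i)).mul (isHomogeneous_X ℝ i)
  have hN : (NN σ).IsHomogeneous 2 := by
    apply IsHomogeneous.sum
    intro i _
    simpa using (isHomogeneous_X ℝ i).pow 2
  induction n using Nat.twoStepInduction with
  | zero => exact isHomogeneous_one _ _
  | one => exact hL
  | more n h1 h2 =>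
    rw [PX]
    have e1 : (2 * (n : MvPolynomial σ ℝ) + 1 + (d : MvPolynomial σ ℝ)) =
      C (2 * (n : ℝ) + 1 + d) := by
        simp only [map_add, map_mul, map_one, map_natCast, map_ofNat]
    have e2 : ((n : MvPolynomial σ ℝ) + 1) = C ((n : ℝ) + 1) := by simp
    rw [e1, e2]
    have a1 := (isHomogeneous_C σ (2 * (n : ℝ) + 1 + d)).mul (hL.mul h2)
    have a2 := (isHomogeneous_C σ ((n : ℝ) + 1)).mul (hN.mul h1)
    rw [show 0 + (1 + (n + 1)) = n + 2 by omega] at a1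
    rw [show 0 + (2 + n) = n + 2 by omega] at a2
    have a3 := (isHomogeneous_C σ (((n : ℝ) + d)⁻¹)).mul (a1.sub a2)
    rwa [zero_add] at a3

lemma Dx_L (x : σ → ℝ) (hx : ∑ i, x i ^ 2 = 1) : Dx x (Lx x) = 1 := by
  rw [Dx_apply]
  simp only [pd_L, ← C_mul, ← map_sum]
  rw [← C_1, ← hx]; congr 1; simp [sq]

lemma Dx_N (x : σ → ℝ) : Dx x (NN σ) = 2 * Lx x := by
  rw [Dx_apply, Lx, Finset.mul_sum]
  apply Finset.sum_congr rfl
  intro i _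
  rw [pd_N]; ring

lemma PX_Dx (d : ℕ) (hd : 2 ≤ d) (x : σ → ℝ) (hx : ∑ i, x i ^ 2 = 1) (n : ℕ) :
    Dx x (PX d x (n + 1)) = ((n : MvPolynomial σ ℝ) + 1) * PX d x n := by
  induction n using Nat.strong_induction_on with
  | _ n ih =>
  match n with
  | 0 => simp [PX, Dx_L x hx]
  | 1 =>
    have rc := PX_rec d hd x 0
    have drc := congrArg (Dx x) rc
    apply mul_left_cancel₀ (PX_ne d hd 0)
    simp only [Derivation.leibniz, map_add, map_sub, Derivation.map_natCast, smul_eq_mul,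
      Derivation.map_one_eq_zero, Dx_N] at drc
    have h2 : Dx x (2 : MvPolynomial σ ℝ) = 0 := by
      simpa using (Dx x).map_natCast 2
    simp only [PX, zero_add, Dx_L x hx, h2, Derivation.map_one_eq_zero] at drc ⊢
    push_cast at drc ⊢
    linear_combination drc
  | n + 2 =>
    have i1 := ih (n + 1) (by omega)
    have i0 := ih n (by omega)
    have rc := PX_rec d hd x (n + 1)
    have rc0 := PX_rec d hd x n
    have drc := congrArg (Dx x) rc
    have h2 : Dx x (2 : MvPolynomial σ ℝ) = 0 := by
      simpa using (Dx x).map_natCast 2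
    apply mul_left_cancel₀ (PX_ne d hd (n + 1))
    simp only [Derivation.leibniz, map_add, map_sub, Derivation.map_natCast, smul_eq_mul,
      Derivation.map_one_eq_zero, Dx_N, Dx_L x hx, h2, i1, i0] at drc
    push_cast at drc ⊢
    rw [show n + 1 + 1 = n + 2 by omega, show n + 1 + 2 = n + 2 + 1 by omega] at drc
    push_cast at drc
    linear_combination drc - ((n : MvPolynomial σ ℝ) + 2) * rc0

lemma PX_Lap (d : ℕ) (hd : 2 ≤ d) (hc : Fintype.card σ = d + 1) (x : σ → ℝ)
    (hx : ∑ i, x i ^ 2 = 1) (n : ℕ) : Lap (PX d x n) = 0 := by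
  induction n using Nat.twoStepInduction with
  | zero => simp [PX, Lap_apply]
  | one => simp [PX, Lap_apply, pd_L]
  | more n h1 h2 =>
    have rc := PX_rec d hd x n
    have cm : ∀ (r : ℝ) (q : MvPolynomial σ ℝ), Lap (C r * q) = C r * Lap q := fun r q => by
      rw [← smul_eq_C_mul, map_smul, smul_eq_C_mul]
    have e0 : ((n : MvPolynomial σ ℝ) + (d : MvPolynomial σ ℝ)) = C ((n : ℝ) + d) := by simp
    have e1 : (2 * (n : MvPolynomial σ ℝ) + 1 + (d : MvPolynomial σ ℝ)) =
      C (2 * (n : ℝ) + 1 + d) := by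
        simp only [map_add, map_mul, map_one, map_natCast, map_ofNat]
    have e2 : ((n : MvPolynomial σ ℝ) + 1) = C ((n : ℝ) + 1) := by simp
    apply mul_left_cancel₀ (PX_ne d hd n)
    have := congrArg Lap rc
    rw [e0, e1, e2] at this
    rw [map_sub, cm, cm, cm, Lap_L, Lap_N _ n (PX_hom d x n), h1, h2, PX_Dx d hd x hx, hc,
      ← e0, ← e1, ← e2] at this
    rw [this]
    push_cast
    ring

/-- normalization constants -/
noncomputable def AA (d : ℕ) : ℕ → ℝ
  | 0 => 1
  | 1 => 1
  | n + 2 => ((n : ℝ) + d)⁻¹ * (2 * n + 1 + d) * (n + 2) * AA d (n + 1)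

lemma AA_pos (d : ℕ) (hd : 2 ≤ d) (n : ℕ) : 0 < AA d n := by
  have : (0 : ℝ) < d := by positivity
  induction n using Nat.twoStepInduction with
  | zero => simp [AA]
  | one => simp [AA]
  | more n h1 h2 => rw [AA]; positivity

lemma eval_Dx (x : σ → ℝ) (q : MvPolynomial σ ℝ) (n : ℕ) (hq : q.IsHomogeneous n) :
    eval x (Dx x q) = n * eval x q := by
  have h := congrArg (eval x) hq.sum_X_mul_pderiv
  rw [Dx_apply]
  simpa using h

lemma Dx_hom (x : σ → ℝ) (q : MvPolynomial σ ℝ) (n : ℕ) (hq : q.IsHomogeneous (n + 1)) :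
    (Dx x q).IsHomogeneous n := by
  rw [Dx_apply]
  apply IsHomogeneous.sum
  intro i _
  have := (isHomogeneous_C σ (x i)).mul (hq.pderiv (i := i))
  simpa using this

lemma FB_one (q : MvPolynomial σ ℝ) (hq : q.IsHomogeneous 0) (x : σ → ℝ) :
    FB 1 q = eval x q := by
  have h1 : (1 : MvPolynomial σ ℝ) = monomial 0 1 := rfl
  have h2 : q = C (coeff 0 q) := totalDegree_eq_zero_iff_eq_C.1 (by simpa using hq.totalDegree_le)
  rw [h1, FB_monomial]
  conv_rhs => rw [h2]
  simp [mfac]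

lemma FB_repr (d : ℕ) (hd : 2 ≤ d) (x : σ → ℝ) (n : ℕ) :
    ∀ q : MvPolynomial σ ℝ, q.IsHomogeneous n → Lap q = 0 →
      FB (PX d x n) q = AA d n * eval x q := by
  induction n with
  | zero =>
    intro q hq _
    rw [PX, FB_one q hq x, AA, one_mul]
  | succ n ih =>
    match n with
    | 0 =>
      intro q hq _
      have := FB_L x 1 q
      rw [mul_one] at this
      simp only [PX, zero_add, this, AA]
      rw [FB_one _ (Dx_hom x q 0 hq) x, eval_Dx x q _ hq]
      simp
    | n + 1 =>
      intro q hq hL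
      have e1 : (2 * (n : MvPolynomial σ ℝ) + 1 + (d : MvPolynomial σ ℝ)) =
        C (2 * (n : ℝ) + 1 + d) := by
        simp only [map_add, map_mul, map_one, map_natCast, map_ofNat]
      have e2 : ((n : MvPolynomial σ ℝ) + 1) = C ((n : ℝ) + 1) := by simp
      rw [PX, e1, e2, ← smul_eq_C_mul, ← smul_eq_C_mul, ← smul_eq_C_mul, map_smul, map_sub,
        map_smul, map_smul, LinearMap.smul_apply, LinearMap.sub_apply, LinearMap.smul_apply,
        LinearMap.smul_apply, FB_L, FB_N, hL, ih (Dx x q) (Dx_hom x q _ hq)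
        (by rw [Lap_Dx, hL, map_zero]), eval_Dx x q _ hq]
      simp only [AA, smul_eq_mul, map_zero]
      push_cast
      ring

lemma PX_eval (d : ℕ) (x y : σ → ℝ) (hy : ∑ i, y i ^ 2 = 1) (n : ℕ) :
    eval y (PX d x n) = Geg d n (∑ i, x i * y i) := by
  have hL : eval y (Lx x) = ∑ i, x i * y i := by simp [Lx]
  have hN : eval y (NN σ) = 1 := by simp [NN, hy]
  induction n using Nat.twoStepInduction with
  | zero => simp [PX, Geg]
  | one => simp [PX, Geg, hL]
  | more n h1 h2 =>
    simp only [PX, Geg, map_mul, map_sub, map_add, h1, h2, hL, hN, eval_C, map_natCast, map_one,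
      map_ofNat]
    ring

lemma psd_aux (d : ℕ) (hd : 2 ≤ d) (hc : Fintype.card σ = d + 1) {n : ℕ} (x : Fin n → σ → ℝ)
    (hx : ∀ j, ∑ i, x j i ^ 2 = 1) (w : Fin n → ℝ) (l : ℕ) :
    0 ≤ ∑ j, ∑ k, w j * w k * Geg d l (∑ i, x j i * x k i) := by
  have h := FB_nonneg (∑ j, w j • PX d (x j) l)
  have e : FB (∑ j, w j • PX d (x j) l) (∑ j, w j • PX d (x j) l) =
      AA d l * ∑ j, ∑ k, w j * w k * Geg d l (∑ i, x j i * x k i) := by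
    simp only [map_sum, LinearMap.sum_apply, map_smul, LinearMap.smul_apply, smul_eq_mul,
      Finset.mul_sum]
    rw [Finset.sum_comm]
    apply Finset.sum_congr rfl
    intro j _
    apply Finset.sum_congr rfl
    intro k _
    rw [FB_repr d hd (x j) l _ (PX_hom d (x k) l) (PX_Lap d hd hc (x k) (hx k) l),
      PX_eval d _ _ (hx j)]
    simp only [mul_comm (x k _)]
    ring
  rw [e] at h
  exact (mul_nonneg_iff_of_pos_left (AA_pos d hd l)).1 h
end

lemma psd (d : ℕ) (hd : 2 ≤ d) {n : ℕ}
    (x : Fin n → Metric.sphere (0 : EuclideanSpace ℝ (Fin (d + 1))) 1) (w : Fin n → ℝ) (l : ℕ) :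
    0 ≤ ∑ j, ∑ k, w j * w k *
      Geg d l ⟪(x j : EuclideanSpace ℝ (Fin (d + 1))), (x k : EuclideanSpace ℝ (Fin (d + 1)))⟫ := by
  have h := psd_aux d hd (by simp) (fun j i => (x j : EuclideanSpace ℝ (Fin (d + 1))) i)
    (fun j => by
      have : ‖(x j : EuclideanSpace ℝ (Fin (d + 1)))‖ = 1 := by simpa using (x j).2
      have h2 := EuclideanSpace.real_norm_sq_eq (x j : EuclideanSpace ℝ (Fin (d + 1)))
      rw [this] at h2
      simpa using h2.symm) w l
  refine h.trans_eq ?_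
  apply Finset.sum_congr rfl
  intro j _
  apply Finset.sum_congr rfl
  intro k _
  congr 2
  rw [PiLp.inner_apply]
  simp [mul_comm]

/-- Geg at the inner product of two points of the sphere. -/
noncomputable def GS (d : ℕ) (l : ℕ)
    (x y : Metric.sphere (0 : EuclideanSpace ℝ (Fin (d + 1))) 1) : ℝ :=
  Geg d l ⟪(x : EuclideanSpace ℝ (Fin (d + 1))), (y : EuclideanSpace ℝ (Fin (d + 1)))⟫

lemma GS_symm (d l : ℕ) (x y : Metric.sphere (0 : EuclideanSpace ℝ (Fin (d + 1))) 1) :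
    GS d l x y = GS d l y x := by
  unfold GS; rw [real_inner_comm]

lemma GS_self (d : ℕ) (hd : 2 ≤ d) (l : ℕ)
    (x : Metric.sphere (0 : EuclideanSpace ℝ (Fin (d + 1))) 1) : GS d l x x = 1 := by
  unfold GS
  have : ‖(x : EuclideanSpace ℝ (Fin (d + 1)))‖ = 1 := by simpa using x.2
  rw [real_inner_self_eq_norm_sq, this, one_pow, Geg_one d hd]

lemma GS_abs (d : ℕ) (hd : 2 ≤ d) (l : ℕ)
    (x y : Metric.sphere (0 : EuclideanSpace ℝ (Fin (d + 1))) 1) : |GS d l x y| ≤ 1 := by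
  have h1 : 0 ≤ ∑ j, ∑ k, ![(1 : ℝ), 1] j * ![(1 : ℝ), 1] k * GS d l (![x, y] j) (![x, y] k) :=
    psd d hd ![x, y] ![(1 : ℝ), 1] l
  have h2 : 0 ≤ ∑ j, ∑ k, ![(1 : ℝ), -1] j * ![(1 : ℝ), -1] k * GS d l (![x, y] j) (![x, y] k) :=
    psd d hd ![x, y] ![(1 : ℝ), -1] l
  simp only [Fin.sum_univ_two, Matrix.cons_val_zero, Matrix.cons_val_one, GS_self d hd] at h1 h2
  rw [GS_symm d l y x] at h1 h2
  rw [abs_le]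
  constructor <;> linarith

lemma vyb {n : ℕ} (A : Fin n → Fin n → ℝ) (hs : ∀ i j, A i j = A j i)
    (hp : ∀ v : Fin n → ℝ, 0 ≤ ∑ j, ∑ k, v j * v k * A j k) (w : Fin n → ℝ) :
    (∑ j, w j * A j j) ^ 2 ≤ n * ∑ j, ∑ k, w j * w k * A j k ^ 2 := by
  have hA : (Matrix.of A).PosSemidef := by
    apply Matrix.PosSemidef.of_dotProduct_mulVec_nonneg
    · ext i j; simp [hs j i]
    · intro v
      refine (hp v).trans_eq ?_
      simp only [dotProduct, Matrix.mulVec, Finset.mul_sum, Matrix.of_apply, Pi.star_apply,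
        star_trivial]
      apply Finset.sum_congr rfl; intro j _
      apply Finset.sum_congr rfl; intro k _
      ring
  obtain ⟨B, hB⟩ : ∃ B : Matrix (Fin n) (Fin n) ℝ, Matrix.of A = B.conjTranspose * B := by
    open scoped MatrixOrder in
    exact CStarAlgebra.nonneg_iff_eq_star_mul_self.1 hA.nonneg
  have hAB : ∀ j k, A j k = ∑ p, B p j * B p k := by
    intro j k
    have := congrFun (congrFun hB j) k
    simpa [Matrix.mul_apply] using this
  set M : Fin n → Fin n → ℝ := fun p q => ∑ j, w j * B p j * B q j with hM
  have e1 : ∑ j, w j * A j j = ∑ p, M p p := by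
    simp only [hM, hAB, Finset.mul_sum]
    rw [Finset.sum_comm]
    apply Finset.sum_congr rfl; intro j _
    apply Finset.sum_congr rfl; intro k _
    ring
  have e2 : ∑ j, ∑ k, w j * w k * A j k ^ 2 = ∑ p, ∑ q, M p q ^ 2 := by
    have l1 : ∀ j k, w j * w k * A j k ^ 2 =
        ∑ p, ∑ q, (w j * B p j * B q j) * (w k * B p k * B q k) := by
      intro j k
      rw [hAB, sq, Finset.sum_mul_sum, Finset.mul_sum]
      apply Finset.sum_congr rfl; intro p _
      rw [Finset.mul_sum]
      apply Finset.sum_congr rfl; intro q _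
      ring
    have l2 : ∀ p q, M p q ^ 2 = ∑ j, ∑ k, (w j * B p j * B q j) * (w k * B p k * B q k) := by
      intro p q
      rw [hM, sq, Finset.sum_mul_sum]
    simp only [l1, l2]
    calc ∑ j, ∑ k, ∑ p, ∑ q, (w j * B p j * B q j) * (w k * B p k * B q k)
        = ∑ j, ∑ p, ∑ k, ∑ q, (w j * B p j * B q j) * (w k * B p k * B q k) := by
          apply Finset.sum_congr rfl; intro j _; exact Finset.sum_comm
      _ = ∑ p, ∑ j, ∑ k, ∑ q, (w j * B p j * B q j) * (w k * B p k * B q k) := Finset.sum_comm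
      _ = ∑ p, ∑ j, ∑ q, ∑ k, (w j * B p j * B q j) * (w k * B p k * B q k) := by
          apply Finset.sum_congr rfl; intro p _
          apply Finset.sum_congr rfl; intro j _; exact Finset.sum_comm
      _ = _ := by
          apply Finset.sum_congr rfl; intro p _; exact Finset.sum_comm
  rw [e1, e2]
  have h1 := sq_sum_le_card_mul_sum_sq (s := (Finset.univ : Finset (Fin n))) (f := fun p => M p p)
  rw [Finset.card_univ, Fintype.card_fin] at h1
  refine h1.trans (mul_le_mul_of_nonneg_left ?_ (Nat.cast_nonneg n))
  apply Finset.sum_le_sum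
  intro p _
  exact Finset.single_le_sum (f := fun q => M p q ^ 2) (fun q _ => sq_nonneg _) (Finset.mem_univ p)

/-- coefficients of the square -/
noncomputable def nu (d : ℕ) (hd : 2 ≤ d) (mu : ℕ → ℝ) (N k : ℕ) : ℝ :=
  ∑ l ∈ Finset.range N, ∑ s ∈ Finset.range N, mu l * mu s * (J d hd l s k / hh d hd k)

/-- quadratic form of degree `l` -/
noncomputable def QQ (d : ℕ) {n : ℕ}
    (x : Fin n → Metric.sphere (0 : EuclideanSpace ℝ (Fin (d + 1))) 1) (w : Fin n → ℝ) (l : ℕ) : ℝ :=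
  ∑ j, ∑ k, w j * w k * GS d l (x j) (x k)

lemma QQ_nonneg (d : ℕ) (hd : 2 ≤ d) {n : ℕ}
    (x : Fin n → Metric.sphere (0 : EuclideanSpace ℝ (Fin (d + 1))) 1) (w : Fin n → ℝ) (l : ℕ) :
    0 ≤ QQ d x w l := psd d hd x w l

lemma QQ_zero (d : ℕ) {n : ℕ}
    (x : Fin n → Metric.sphere (0 : EuclideanSpace ℝ (Fin (d + 1))) 1) (w : Fin n → ℝ) :
    QQ d x w 0 = (∑ j, w j) ^ 2 := by
  simp only [QQ, GS, Geg, mul_one]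
  rw [sq, Finset.sum_mul_sum]

lemma QQ_comb (d : ℕ) {n : ℕ}
    (x : Fin n → Metric.sphere (0 : EuclideanSpace ℝ (Fin (d + 1))) 1) (w : Fin n → ℝ)
    (a : ℕ → ℝ) (N : ℕ) :
    ∑ j, ∑ k, w j * w k * (∑ l ∈ Finset.range N, a l * GS d l (x j) (x k)) =
      ∑ l ∈ Finset.range N, a l * QQ d x w l := by
  simp only [QQ, Finset.mul_sum]
  rw [Finset.sum_comm' (t' := Finset.univ) (s' := fun _ => Finset.range N) (by simp)]
  apply Finset.sum_congr rfl; intro j _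
  rw [Finset.sum_comm]
  apply Finset.sum_congr rfl; intro k _
  apply Finset.sum_congr rfl; intro l _
  ring

lemma sq_lin (d : ℕ) (hd : 2 ≤ d) (mu : ℕ → ℝ) (N : ℕ)
    (x y : Metric.sphere (0 : EuclideanSpace ℝ (Fin (d + 1))) 1) :
    (∑ l ∈ Finset.range N, mu l * GS d l x y) ^ 2 =
      ∑ k ∈ Finset.range (2 * N), nu d hd mu N k * GS d k x y := by
  rw [sq, Finset.sum_mul_sum]
  have l1 : ∀ l ∈ Finset.range N, ∀ s ∈ Finset.range N,
      mu l * GS d l x y * (mu s * GS d s x y) =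
      ∑ k ∈ Finset.range (2 * N), mu l * mu s * (J d hd l s k / hh d hd k) * GS d k x y := by
    intro l hl s hs
    rw [Finset.mem_range] at hl hs
    have h := Geg_lin d hd l s (2 * N) (by omega)
      ⟪(x : EuclideanSpace ℝ (Fin (d + 1))), (y : EuclideanSpace ℝ (Fin (d + 1)))⟫
    have h2 : mu l * GS d l x y * (mu s * GS d s x y) =
      mu l * mu s * (GS d l x y * GS d s x y) := by ring
    rw [h2]
    unfold GS
    rw [h, Finset.mul_sum]
    apply Finset.sum_congr rfl; intro k _
    ring
  rw [Finset.sum_congr rfl fun l hl => Finset.sum_congr rfl (l1 l hl)]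
  simp only [nu, Finset.sum_mul]
  rw [Finset.sum_congr rfl fun l hl => Finset.sum_comm]
  rw [Finset.sum_comm]

lemma core (d : ℕ) (hd : 2 ≤ d) {n : ℕ}
    (x : Fin n → Metric.sphere (0 : EuclideanSpace ℝ (Fin (d + 1))) 1) (w : Fin n → ℝ)
    (mu : ℕ → ℝ) (hmu : ∀ l, 0 ≤ mu l) (N : ℕ) :
    ((∑ l ∈ Finset.range N, mu l) * ∑ j, w j) ^ 2 ≤
      n * ∑ k ∈ Finset.range (2 * N), nu d hd mu N k * QQ d x w k := by
  have h := vyb (fun j k => ∑ l ∈ Finset.range N, mu l * GS d l (x j) (x k))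
    (fun j k => by simp only [GS_symm d _ (x j) (x k)])
    (fun v => by
      rw [QQ_comb]
      exact Finset.sum_nonneg fun l _ => mul_nonneg (hmu l) (QQ_nonneg d hd x v l)) w
  simp only [sq_lin d hd, QQ_comb, GS_self d hd, mul_one] at h
  rw [← Finset.sum_mul, mul_comm] at h
  exact h

lemma nu_zero (d : ℕ) (hd : 2 ≤ d) (mu : ℕ → ℝ) (hmu : ∀ l, 0 ≤ mu l)
    (h0 : ∀ l, mu l ≤ mu 0) (N : ℕ) :
    nu d hd mu N 0 ≤ mu 0 * ∑ l ∈ Finset.range N, mu l := by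
  rw [nu, Finset.mul_sum]
  apply Finset.sum_le_sum
  intro l hl
  have e : ∀ s, J d hd l s 0 = if s = l then hh d hd l else 0 := by
    intro s; rw [J_swap13, J_zero]
  simp only [e, hh_zero, div_one, mul_ite, mul_zero]
  rw [Finset.sum_ite_eq' , if_pos hl]
  have h1 : hh d hd l ≤ 1 := by
    rw [← hh_zero d hd]; exact hh_anti d hd (Nat.zero_le l)
  have h2 := (hh_pos d hd l).le
  calc mu l * mu l * hh d hd l ≤ mu l * mu l * 1 :=
        mul_le_mul_of_nonneg_left h1 (mul_nonneg (hmu l) (hmu l))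
    _ ≤ mu 0 * mu l := by
        rw [mul_one]; exact mul_le_mul_of_nonneg_right (h0 l) (hmu l)

lemma nu_le (d : ℕ) (hd : 2 ≤ d) (lam mu : ℕ → ℝ) (hmu : ∀ l, 0 ≤ mu l)
    (hlam : ∀ k, 0 ≤ lam k) (hmono : ∀ k l, k ≤ l → lam l ≤ lam k)
    (hml : ∀ l, mu l ≤ lam (2 * l))
    (c : ℝ) (hc : 1 < c) (hch : ∀ ℓ : ℕ, hsqG d (ℓ / 2) ≤ c * hsqG d ℓ) (N k : ℕ) :
    nu d hd mu N k ≤ 2 * c * lam k * ∑ l ∈ Finset.range N, mu l := by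
  have hk := hh_pos d hd k
  -- one-sided estimate
  have key : ∀ l s, k ≤ 2 * s → mu l * mu s * (J d hd l s k / hh d hd k) ≤
      c * lam k * (mu l * (J d hd l k s / hh d hd s)) := by
    intro l s hks
    have hs := hh_pos d hd s
    have hJ := J_nonneg d hd l s k
    have h1 : mu s ≤ lam k := (hml s).trans (hmono _ _ hks)
    have h2 : hh d hd s ≤ c * hh d hd k := by
      have := hch k
      rw [← hh_eq d hd, ← hh_eq d hd] at this
      exact (hh_anti d hd (by omega : k / 2 ≤ s)).trans this
    rw [J_swap23 d hd l k s]
    have h3 : J d hd l s k / hh d hd k ≤ c * (J d hd l s k / hh d hd s) := by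
      rw [div_le_iff₀ hk, mul_div_assoc', div_mul_eq_mul_div, le_div_iff₀ hs]
      nlinarith [mul_le_mul_of_nonneg_left h2 hJ]
    calc mu l * mu s * (J d hd l s k / hh d hd k)
        ≤ mu l * lam k * (c * (J d hd l s k / hh d hd s)) := by
          apply mul_le_mul _ h3 (by positivity) (mul_nonneg (hmu l) (hlam k))
          exact mul_le_mul_of_nonneg_left h1 (hmu l)
      _ = _ := by ring
  have pos : ∀ l s, 0 ≤ c * lam k * (mu l * (J d hd l k s / hh d hd s)) := by
    intro l s
    have := J_nonneg d hd l k s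
    have := (hh_pos d hd s).le
    have := hmu l
    have := hlam k
    have : 0 ≤ c := by linarith
    positivity
  have both : ∀ l s, mu l * mu s * (J d hd l s k / hh d hd k) ≤
      c * lam k * (mu l * (J d hd l k s / hh d hd s)) +
      c * lam k * (mu s * (J d hd s k l / hh d hd l)) := by
    intro l s
    by_cases h1 : k ≤ 2 * s
    · exact (key l s h1).trans (le_add_of_nonneg_right (pos s l))
    by_cases h2 : k ≤ 2 * l
    · have := key s l h2
      rw [J_swap12 d hd s l k, mul_comm (mu s) (mu l)] at this
      exact this.trans (le_add_of_nonneg_left (pos l s))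
    · have : J d hd l s k = 0 := by
        rw [J_swap23]; exact J_tri d hd l k s (by omega)
      rw [this, zero_div, mul_zero]
      exact add_nonneg (pos l s) (pos s l)
  have hc0 : 0 ≤ c * lam k := mul_nonneg (by linarith) (hlam k)
  have one : ∑ l ∈ Finset.range N, ∑ s ∈ Finset.range N,
      c * lam k * (mu l * (J d hd l k s / hh d hd s)) ≤ c * lam k * ∑ l ∈ Finset.range N, mu l := by
    rw [Finset.mul_sum]
    apply Finset.sum_le_sum
    intro l _
    rw [← Finset.mul_sum, ← Finset.mul_sum]
    apply mul_le_mul_of_nonneg_left _ hc0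
    exact (mul_le_mul_of_nonneg_left (J_sum_le d hd l k N) (hmu l)).trans_eq (mul_one _)
  have two : ∑ l ∈ Finset.range N, ∑ s ∈ Finset.range N,
      c * lam k * (mu s * (J d hd s k l / hh d hd l)) ≤ c * lam k * ∑ l ∈ Finset.range N, mu l := by
    rw [Finset.sum_comm]; exact one
  calc nu d hd mu N k ≤ ∑ l ∈ Finset.range N, ∑ s ∈ Finset.range N,
        (c * lam k * (mu l * (J d hd l k s / hh d hd s)) +
        c * lam k * (mu s * (J d hd s k l / hh d hd l))) :=
        Finset.sum_le_sum fun l _ => Finset.sum_le_sum fun s _ => both l s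
    _ ≤ _ := by
      simp only [Finset.sum_add_distrib]
      linarith

lemma hasSum_form (d : ℕ) (hd : 2 ≤ d) {n : ℕ} (lam : ℕ → ℝ) (hlam : ∀ k, 0 ≤ lam k)
    (hsum : Summable lam)
    (x : Fin n → Metric.sphere (0 : EuclideanSpace ℝ (Fin (d + 1))) 1) (w : Fin n → ℝ) :
    HasSum (fun l => lam l * QQ d x w l)
      (∑ j, ∑ k, w j * w k * sphKernel d lam (x j) (x k)) := by
  have h : ∀ j k, HasSum (fun l => lam l * GS d l (x j) (x k)) (sphKernel d lam (x j) (x k)) := by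
    intro j k
    have : Summable (fun l => lam l * GS d l (x j) (x k)) := by
      apply Summable.of_norm_bounded hsum
      intro l
      rw [norm_mul, Real.norm_eq_abs, Real.norm_eq_abs, abs_of_nonneg (hlam l)]
      exact (mul_le_mul_of_nonneg_left (GS_abs d hd l _ _) (hlam l)).trans_eq (mul_one _)
    exact this.hasSum
  have h2 := hasSum_sum (s := (Finset.univ : Finset (Fin n))) fun j _ =>
    hasSum_sum (s := (Finset.univ : Finset (Fin n))) fun k _ => (h j k).mul_left (w j * w k)
  suffices e : (fun l => lam l * QQ d x w l) =
      fun l => ∑ j, ∑ k, w j * w k * (lam l * GS d l (x j) (x k)) by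
    rw [e]; exact h2
  funext l
  simp only [QQ, Finset.mul_sum]
  apply Finset.sum_congr rfl; intro j _
  apply Finset.sum_congr rfl; intro k _
  ring

lemma fin_ineq (d : ℕ) (hd : 2 ≤ d) {n : ℕ} (lam mu : ℕ → ℝ) (hmu : ∀ l, 0 ≤ mu l)
    (h0 : ∀ l, mu l ≤ mu 0)
    (hlam : ∀ k, 0 ≤ lam k) (hmono : ∀ k l, k ≤ l → lam l ≤ lam k) (hsum : Summable lam)
    (hml : ∀ l, mu l ≤ lam (2 * l))
    (c : ℝ) (hc : 1 < c) (hch : ∀ ℓ : ℕ, hsqG d (ℓ / 2) ≤ c * hsqG d ℓ) (N : ℕ) (hN : 1 ≤ N)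
    (x : Fin n → Metric.sphere (0 : EuclideanSpace ℝ (Fin (d + 1))) 1) (w : Fin n → ℝ) :
    (∑ l ∈ Finset.range N, mu l) * (∑ j, w j) ^ 2 ≤
      n * (mu 0 * (∑ j, w j) ^ 2 +
        2 * c * ((∑ j, ∑ k, w j * w k * sphKernel d lam (x j) (x k)) - lam 0 * (∑ j, w j) ^ 2)) := by
  set S := ∑ j, w j
  set T := ∑ j, ∑ k, w j * w k * sphKernel d lam (x j) (x k)
  set m := ∑ l ∈ Finset.range N, mu l with hm
  have hT := hasSum_form d hd lam hlam hsum x w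
  have hle : ∑ k ∈ Finset.range (2 * N), lam k * QQ d x w k ≤ T :=
    sum_le_hasSum _ (fun k _ => mul_nonneg (hlam k) (QQ_nonneg d hd x w k)) hT
  obtain ⟨M, hM⟩ : ∃ M, 2 * N = M + 1 := ⟨2 * N - 1, by omega⟩
  have hcore := core d hd x w mu hmu N
  rw [hM, Finset.sum_range_succ', QQ_zero] at hle hcore
  have hm0 : 0 ≤ m := Finset.sum_nonneg fun l _ => hmu l
  have hrest : ∑ k ∈ Finset.range M, nu d hd mu N (k + 1) * QQ d x w (k + 1) ≤
      2 * c * m * ∑ k ∈ Finset.range M, lam (k + 1) * QQ d x w (k + 1) := by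
    rw [Finset.mul_sum]
    apply Finset.sum_le_sum
    intro k _
    have := mul_le_mul_of_nonneg_right
      (nu_le d hd lam mu hmu hlam hmono hml c hc hch N (k + 1)) (QQ_nonneg d hd x w (k + 1))
    refine this.trans_eq ?_
    rw [← hm]; ring
  have hz := mul_le_mul_of_nonneg_right (nu_zero d hd mu hmu h0 N) (sq_nonneg S)
  have hR : ∑ k ∈ Finset.range M, lam (k + 1) * QQ d x w (k + 1) ≤ T - lam 0 * S ^ 2 := by
    linarith
  have hR2 := mul_le_mul_of_nonneg_left hR (by positivity : 0 ≤ 2 * c * m)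
  have hR0 : 0 ≤ ∑ k ∈ Finset.range M, lam (k + 1) * QQ d x w (k + 1) :=
    Finset.sum_nonneg fun k _ => mul_nonneg (hlam _) (QQ_nonneg d hd x w _)
  have hn : (0 : ℝ) ≤ n := Nat.cast_nonneg n
  have hall : (m * S) ^ 2 ≤ n * (mu 0 * m * S ^ 2 + 2 * c * m * (T - lam 0 * S ^ 2)) := by
    refine hcore.trans (mul_le_mul_of_nonneg_left ?_ hn)
    rw [← hm] at hz
    linarith
  rcases hm0.eq_or_lt with h | h
  · rw [← h, zero_mul]
    have := hmu 0
    have : 0 ≤ T - lam 0 * S ^ 2 := hR0.trans hR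
    have : 0 ≤ c := by linarith
    positivity
  · refine le_of_mul_le_mul_left ?_ h
    linarith

lemma main (d : ℕ) (hd : 2 ≤ d) {n : ℕ} (hn : 1 ≤ n) (lam : ℕ → ℝ)
    (hlam : ∀ k, 0 ≤ lam k) (hmono : ∀ k l, k ≤ l → lam l ≤ lam k) (hsum : Summable lam)
    (c : ℝ) (hc : 1 < c) (hch : ∀ ℓ : ℕ, hsqG d (ℓ / 2) ≤ c * hsqG d ℓ)
    (x : Fin n → Metric.sphere (0 : EuclideanSpace ℝ (Fin (d + 1))) 1) (w : Fin n → ℝ) :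
    (∑' ℓ : ℕ, if 2 * c * (n : ℝ) < (ℓ : ℝ) then lam (2 * ℓ) else 0) * (∑ j, w j) ^ 2 ≤
      2 * c * n *
        ((∑ j, ∑ k, w j * w k * sphKernel d lam (x j) (x k)) - lam 0 * (∑ j, w j) ^ 2) := by
  set f : ℕ → ℝ := fun ℓ => if 2 * c * (n : ℝ) < (ℓ : ℝ) then lam (2 * ℓ) else 0 with hf
  set S := ∑ j, w j
  set R := (∑ j, ∑ k, w j * w k * sphKernel d lam (x j) (x k)) - lam 0 * S ^ 2 with hR
  have hn1 : (1 : ℝ) ≤ n := by exact_mod_cast hn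
  have hcn : 0 ≤ 2 * c * n := by positivity
  obtain ⟨L, hL⟩ : ∃ L, L = ⌊2 * c * (n : ℝ)⌋₊ + 1 := ⟨_, rfl⟩
  have hLge : 2 * c * n ≤ (L : ℝ) := by
    rw [hL]; push_cast; exact (Nat.lt_floor_add_one _).le
  have hfl : ∀ l, l < L → f l = 0 := by
    intro l hl
    simp only [hf]
    rw [if_neg]
    rw [not_lt]
    exact (Nat.le_floor_iff hcn).1 (by omega)
  have hf0 : ∀ l, 0 ≤ f l := fun l => by
    simp only [hf]; split_ifs
    · exact hlam _
    · exact le_rfl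
  have hfle : ∀ l, f l ≤ lam (2 * l) := fun l => by
    simp only [hf]; split_ifs
    · exact le_rfl
    · exact hlam _
  have hfs : Summable f := by
    apply Summable.of_nonneg_of_le hf0 hfle
    exact hsum.comp_injective (fun a b h => by simpa using h : Function.Injective fun l : ℕ => 2 * l)
  set mu : ℕ → ℝ := fun l => lam (2 * max l L) with hmu
  have hfin : ∀ N, L ≤ N → (∑ l ∈ Finset.range N, f l) * S ^ 2 ≤ 2 * c * n * R := by
    intro N hN
    have h := fin_ineq d hd lam mu (fun l => hlam _)
      (fun l => hmono _ _ (by simp [hmu]))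
      hlam hmono hsum (fun l => hmono _ _ (by simp [hmu])) c hc hch N (by omega) x w
    have hm : L * mu 0 + ∑ l ∈ Finset.range N, f l ≤ ∑ l ∈ Finset.range N, mu l := by
      obtain ⟨K, rfl⟩ := Nat.exists_eq_add_of_le hN
      rw [Finset.sum_range_add, Finset.sum_range_add,
        Finset.sum_eq_zero (s := Finset.range L) (f := f) fun l hl => hfl l (Finset.mem_range.1 hl),
        zero_add]
      apply add_le_add
      · rw [Finset.sum_congr rfl (g := fun _ => mu 0) fun l hl => ?_]
        · simp
        · have := Finset.mem_range.1 hl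
          simp only [hmu]
          congr 2; omega
      · apply Finset.sum_le_sum
        intro l _
        refine (hfle _).trans_eq ?_
        simp only [hmu]
        congr 2; omega
    have hS := sq_nonneg S
    have hmu0 : 0 ≤ mu 0 := hlam _
    have h1 := mul_le_mul_of_nonneg_right hm hS
    have h2 : (n : ℝ) ≤ L := by nlinarith
    have h3 := mul_le_mul_of_nonneg_right h2 (mul_nonneg hmu0 hS)
    rw [← hR] at h
    nlinarith
  have ht := hfs.hasSum.tendsto_sum_nat.mul_const (S ^ 2)
  apply le_of_tendsto ht
  filter_upwards [Filter.eventually_ge_atTop L] with N hN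
  exact hfin N hN


end S15

/-- For a nonnegative nonincreasing summable sequence `Λ̃` and `c > 1` with
`h_{⌊ℓ/2⌋}² ≤ c h_ℓ²`, one has
`e_n(H_Λ̃)² ≥ min { λ̃₀/2, (1/(4cn)) ∑_{ℓ > 2cn} λ̃_{2ℓ} }`. -/
theorem stmt15 (d : ℕ) (hd : 2 ≤ d) (lam : ℕ → ℝ)
    (hlam : ∀ k, 0 ≤ lam k) (hmono : ∀ k l, k ≤ l → lam l ≤ lam k) (hsum : Summable lam)
    (c : ℝ) (hc : 1 < c) (hch : ∀ ℓ : ℕ, hsqG d (ℓ / 2) ≤ c * hsqG d ℓ) (n : ℕ) :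
    min (lam 0 / 2)
        ((1 / (4 * c * n)) *
          ∑' ℓ : ℕ, if 2 * c * (n : ℝ) < (ℓ : ℝ) then lam (2 * ℓ) else 0) ≤
      enSq d n lam := by
  unfold enSq
  haveI : Nonempty (Metric.sphere (0 : EuclideanSpace ℝ (Fin (d + 1))) 1) :=
    ⟨⟨EuclideanSpace.single 0 1, by simp⟩⟩
  refine le_ciInf fun w => le_ciInf fun x => ?_
  rcases Nat.eq_zero_or_pos n with rfl | hn
  · refine (min_le_right _ _).trans ?_
    simpa using hlam 0
  have h := S15.main d hd hn lam hlam hmono hsum c hc hch x w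
  set F := ∑' ℓ : ℕ, if 2 * c * (n : ℝ) < (ℓ : ℝ) then lam (2 * ℓ) else 0
  set S := ∑ j, w j
  set T := ∑ j, ∑ k, w j * w k * sphKernel d lam (x j) (x k)
  have hn1 : (1 : ℝ) ≤ n := by exact_mod_cast hn
  have hcn : 0 < 2 * c * n := by positivity
  set A := 1 / (4 * c * n) * F with hA
  have hF : F = 2 * c * n * (2 * A) := by
    rw [hA]; field_simp; ring
  rw [hF, mul_assoc] at h
  have h1 : 2 * A * S ^ 2 ≤ T - lam 0 * S ^ 2 := le_of_mul_le_mul_left h hcn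
  set m := min (lam 0 / 2) A
  have hm1 : m ≤ lam 0 / 2 := min_le_left _ _
  have hm2 : m ≤ A := min_le_right _ _
  have hm0 : 0 ≤ m := by
    apply le_min (by linarith [hlam 0])
    rw [hA]
    apply mul_nonneg (by positivity)
    apply tsum_nonneg
    intro l
    split_ifs
    · exact hlam _
    · exact le_rfl
  nlinarith [mul_nonneg (sub_nonneg.2 hm1) (sq_nonneg (1 - S)),
    mul_nonneg (sub_nonneg.2 hm2) (sq_nonneg S), mul_nonneg hm0 (sq_nonneg (2 * S - 1))]
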